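/- Let Ψ₁, Ψ₂ ∈ ℂ³ be the unit vectors parameterized by (θ₁, φ₁, α₁, β₁) and (θ₂, φ₂, α₂, β₂), with θ_i ∈ [0, π], φ_i ∈ [0, π]. With P⁺ = (1/2)(S₊ + T₊), P = (P⁺)^†, the two-site expectation of the P-type one-particle transfer satisfies ⟨Ψ₁ ⊗ Ψ₂, (P⁺ ⊗ P + P ⊗ P⁺)(Ψ₁ ⊗ Ψ₂)⟩ = (1/2) sin θ₁ sin θ₂ cos(φ₁/2) cos(φ₂/2) cos((α₁ − α₂ + β₁ − β₂)/2). -/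

import Mathlib

open Matrix Kronecker

/-- The pseudospin matrix `S_z = diag(1,0,−1)`. -/
noncomputable def Sz : Matrix (Fin 3) (Fin 3) ℂ := !![1, 0, 0; 0, 0, 0; 0, 0, -1]

/-- The pseudospin raising matrix `S₊`. -/
noncomputable def Sp : Matrix (Fin 3) (Fin 3) ℂ := !![0, 1, 0; 0, 0, 1; 0, 0, 0]

/-- `T₊ = S_z S₊ + S₊ S_z`. -/
noncomputable def Tp : Matrix (Fin 3) (Fin 3) ℂ := Sz * Sp + Sp * Sz

/-- The quasi-classical on-site wave function of the charge triplet. -/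
noncomputable def Psi (θ φ α β : ℝ) : Fin 3 → ℂ :=
  ![Complex.exp (-Complex.I * α / 2) * Real.sin (θ / 2) * Real.cos (φ / 2),
    Complex.exp (Complex.I * β / 2) * Real.cos (θ / 2),
    Complex.exp (Complex.I * α / 2) * Real.sin (θ / 2) * Real.sin (φ / 2)]

/-- The Kronecker (tensor) product of two on-site state vectors. -/
noncomputable def tens {m n : Type*} (v : m → ℂ) (w : n → ℂ) : m × n → ℂ :=
  fun p => v p.1 * w p.2

/-- The quantum expectation value `⟨v, A v⟩`. -/
noncomputable def expVal {n : Type*} [Fintype n] (A : Matrix n n ℂ) (v : n → ℂ) : ℂ :=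
  star v ⬝ᵥ A.mulVec v

theorem expVal_add {n : Type*} [Fintype n] (A B : Matrix n n ℂ) (v : n → ℂ) :
    expVal (A + B) v = expVal A v + expVal B v := by
  simp only [expVal, Matrix.add_mulVec, dotProduct_add]

theorem expVal_conjTranspose {n : Type*} [Fintype n] (A : Matrix n n ℂ) (v : n → ℂ) :
    expVal Aᴴ v = star (expVal A v) := by
  rw [expVal, expVal, ← Matrix.star_dotProduct, Matrix.star_mulVec, Matrix.dotProduct_mulVec]

theorem expVal_kronecker_tens {m n : Type*} [Fintype m] [Fintype n]
    (A : Matrix m m ℂ) (B : Matrix n n ℂ) (v : m → ℂ) (w : n → ℂ) :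
    expVal (A ⊗ₖ B) (tens v w) = expVal A v * expVal B w := by
  have h : (A ⊗ₖ B).mulVec (tens v w) = tens (A.mulVec v) (B.mulVec w) := by
    ext ⟨i, j⟩
    simp only [Matrix.mulVec, dotProduct, tens, Matrix.kroneckerMap_apply, Fintype.sum_prod_type,
      Finset.sum_mul_sum]
    exact Finset.sum_congr rfl fun _ _ => Finset.sum_congr rfl fun _ _ => by ring
  rw [expVal, h]
  simp only [expVal, dotProduct, tens, Pi.star_apply, star_mul', Fintype.sum_prod_type,
    Finset.sum_mul_sum]
  exact Finset.sum_congr rfl fun _ _ => Finset.sum_congr rfl fun _ _ => by ring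

/-- `P⁺` is the matrix unit taking the middle basis vector to the first one. -/
theorem half_smul_Sp_add_Tp :
    (1 / 2 : ℂ) • (Sp + Tp) = !![0, 1, 0; 0, 0, 0; 0, 0, 0] := by
  ext i j
  fin_cases i <;> fin_cases j <;>
    norm_num [Sp, Tp, Sz, Matrix.mul_apply, Fin.sum_univ_three]

theorem expVal_Pplus_Psi (θ φ α β : ℝ) :
    expVal ((1 / 2 : ℂ) • (Sp + Tp)) (Psi θ φ α β) =
      ((Real.sin θ * Real.cos (φ / 2) / 2 : ℝ) : ℂ) *
        Complex.exp (((α + β) / 2 : ℝ) * Complex.I) := by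
  have hsin : Real.sin θ = 2 * Real.sin (θ / 2) * Real.cos (θ / 2) := by
    rw [← Real.sin_two_mul, mul_div_cancel₀ θ two_ne_zero]
  have hexp : Complex.exp (((α + β) / 2 : ℝ) * Complex.I) =
      star (Complex.exp (-Complex.I * α / 2)) * Complex.exp (Complex.I * β / 2) := by
    rw [Complex.star_def, ← Complex.exp_conj, ← Complex.exp_add]
    congr 1
    simp only [map_div₀, map_mul, map_neg, Complex.conj_I, Complex.conj_ofReal, map_ofNat]
    push_cast
    ring
  rw [half_smul_Sp_add_Tp, hexp, hsin]
  simp [expVal, Psi, dotProduct, Matrix.mulVec, Fin.sum_univ_three, -Complex.ofReal_sin,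
    -Complex.ofReal_cos]
  ring

/-- The `P`-type one-particle transfer expectation, where `P⁺ = (1/2)(S₊ + T₊)` and
`P = (P⁺)ᴴ`:
`⟨Ψ₁ ⊗ Ψ₂, (P⁺ ⊗ P + P ⊗ P⁺)(Ψ₁ ⊗ Ψ₂)⟩
  = (1/2) sin θ₁ sin θ₂ cos(φ₁/2) cos(φ₂/2) cos((α₁ − α₂ + β₁ − β₂)/2)`. -/
theorem expVal_P_transfer (θ₁ φ₁ α₁ β₁ θ₂ φ₂ α₂ β₂ : ℝ)
    (hθ₁ : θ₁ ∈ Set.Icc 0 Real.pi) (hφ₁ : φ₁ ∈ Set.Icc 0 Real.pi)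
    (hθ₂ : θ₂ ∈ Set.Icc 0 Real.pi) (hφ₂ : φ₂ ∈ Set.Icc 0 Real.pi) :
    expVal (((1 / 2 : ℂ) • (Sp + Tp)) ⊗ₖ ((1 / 2 : ℂ) • (Sp + Tp))ᴴ +
        ((1 / 2 : ℂ) • (Sp + Tp))ᴴ ⊗ₖ ((1 / 2 : ℂ) • (Sp + Tp)))
      (tens (Psi θ₁ φ₁ α₁ β₁) (Psi θ₂ φ₂ α₂ β₂)) =
      ((Real.sin θ₁ * Real.sin θ₂ * Real.cos (φ₁ / 2) * Real.cos (φ₂ / 2) *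
        Real.cos ((α₁ - α₂ + β₁ - β₂) / 2) / 2 : ℝ) : ℂ) := by
  rw [expVal_add, expVal_kronecker_tens, expVal_kronecker_tens, expVal_conjTranspose,
    expVal_conjTranspose, expVal_Pplus_Psi, expVal_Pplus_Psi]
  have hcos : (α₁ - α₂ + β₁ - β₂) / 2 = (α₁ + β₁) / 2 - (α₂ + β₂) / 2 := by ring
  rw [hcos, Real.cos_sub]
  apply Complex.ext <;>
    simp only [Complex.star_def, Complex.add_re, Complex.add_im, Complex.mul_re, Complex.mul_im,
      Complex.conj_re, Complex.conj_im, Complex.ofReal_re, Complex.ofReal_im,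
      Complex.exp_ofReal_mul_I_re, Complex.exp_ofReal_mul_I_im] <;>
    ring
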